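/- Let k ≥ 2 be an integer and let n ≥ 2k. Consider the saturation game (n, M_k), where M_k is the property of admitting a matching of size k. If Max is the first player and k is odd, or Mini is the first player and k is even, then Mini has a strategy guaranteeing that the graph at the end of the game has at most C(2k−1,2) edges; in particular s(n, M_k) ≤ C(2k−1,2) in these cases. -/

import Mathlib

open SimpleGraph

/-- The graph obtained from `G` by adding the edge `e`. -/
def addEdge {V : Type*} (G : SimpleGraph V) (e : Sym2 V) : SimpleGraph V :=
  G ⊔ SimpleGraph.fromEdgeSet {e}

/-- In the saturation game for the monotone property `P`, a move `e` is legal in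
position `G` if `e` is a non-loop non-edge of `G` whose addition keeps `P` unsatisfied. -/
def legalMove {V : Type*} (P : SimpleGraph V → Prop) (G : SimpleGraph V) (e : Sym2 V) : Prop :=
  ¬ e.IsDiag ∧ e ∉ G.edgeSet ∧ ¬ P (addEdge G e)

/-- `GameEnsures P Q turn G` : in the saturation game for the property `P`, played from
position `G` where the protagonist is to move iff `turn = true`, the protagonist has a
strategy guaranteeing that the final (`P`-saturated) graph satisfies `Q`. -/
inductive GameEnsures {V : Type*} (P Q : SimpleGraph V → Prop) : Bool → SimpleGraph V → Prop
  | gameOver (turn : Bool) (G : SimpleGraph V)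
      (hend : ∀ e, ¬ legalMove P G e) (hQ : Q G) : GameEnsures P Q turn G
  | protagonistMove (G : SimpleGraph V) (e : Sym2 V) (hl : legalMove P G e)
      (h : GameEnsures P Q false (addEdge G e)) : GameEnsures P Q true G
  | opponentMove (G : SimpleGraph V) (e₀ : Sym2 V) (hl : legalMove P G e₀)
      (h : ∀ e, legalMove P G e → GameEnsures P Q true (addEdge G e)) :
      GameEnsures P Q false G

/-- The property of admitting a matching of size `k`. -/
def hasMatchingOfSize {V : Type*} (k : ℕ) (G : SimpleGraph V) : Prop :=
  ∃ M : G.Subgraph, M.IsMatching ∧ M.edgeSet.ncard = k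

/-! ### Perfect matchings of vertex sets -/

/-- `PerfectlyMatchable G S`: the subgraph of `G` induced on `S` has a perfect matching. -/
inductive PerfectlyMatchable {V : Type*} [DecidableEq V] (G : SimpleGraph V) : Finset V → Prop
  | empty : PerfectlyMatchable G ∅
  | insertEdge (S : Finset V) (x y : V) (hxy : G.Adj x y) (hx : x ∉ S) (hy : y ∉ S)
      (h : PerfectlyMatchable G S) : PerfectlyMatchable G (insert x (insert y S))

namespace PerfectlyMatchable

variable {V : Type*} [DecidableEq V] {G H : SimpleGraph V} {S T A B : Finset V}

theorem mono (hGH : G ≤ H) (h : PerfectlyMatchable G S) : PerfectlyMatchable H S := by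
  induction h with
  | empty => exact .empty
  | insertEdge S x y hxy hx hy _ ih => exact .insertEdge S x y (hGH hxy) hx hy ih

theorem union (hA : PerfectlyMatchable G A) (hB : PerfectlyMatchable G B) (hAB : Disjoint A B) :
    PerfectlyMatchable G (A ∪ B) := by
  induction hA with
  | empty => simpa using hB
  | insertEdge S x y hxy hx hy _ ih =>
    rw [Finset.insert_union, Finset.insert_union]
    simp only [Finset.disjoint_insert_left] at hAB
    exact .insertEdge _ x y hxy (by simp [hx, hAB.1]) (by simp [hy, hAB.2.1]) (ih hAB.2.2)

theorem glue (hA : PerfectlyMatchable G A) (hB : PerfectlyMatchable G B) (hAB : Disjoint A B)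
    (hS : S = A ∪ B) : PerfectlyMatchable G S :=
  hS ▸ hA.union hB hAB

theorem glueEdge {x y : V} (hA : PerfectlyMatchable G A) (hB : PerfectlyMatchable G B)
    (hAB : Disjoint A B) (hxy : G.Adj x y) (hx : x ∉ A ∪ B) (hy : y ∉ A ∪ B)
    (hS : S = insert x (insert y (A ∪ B))) : PerfectlyMatchable G S :=
  hS ▸ .insertEdge _ x y hxy hx hy (hA.union hB hAB)

theorem even_card_filter (h : PerfectlyMatchable G S) (p : V → Prop) [DecidablePred p]
    (hp : ∀ x y, G.Adj x y → (p x ↔ p y)) : Even (S.filter p).card := by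
  induction h with
  | empty => simp
  | insertEdge S x y hxy hx hy _ ih =>
    by_cases hpx : p x
    · have hpy := (hp x y hxy).1 hpx
      rw [Finset.filter_insert, Finset.filter_insert, if_pos hpx, if_pos hpy,
        Finset.card_insert_of_notMem (by simp [hx, hxy.ne]),
        Finset.card_insert_of_notMem (by simp [hy])]
      grind
    · have hpy := fun h => hpx ((hp x y hxy).2 h)
      rwa [Finset.filter_insert, Finset.filter_insert, if_neg hpx, if_neg hpy]

theorem even_card (h : PerfectlyMatchable G S) : Even S.card := by
  simpa using h.even_card_filter (fun _ => True) (by simp)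

theorem biUnion {ι : Type*} [DecidableEq ι] (s : Finset ι) (f : ι → Finset V)
    (hf : ∀ i ∈ s, PerfectlyMatchable G (f i))
    (hd : ∀ i ∈ s, ∀ j ∈ s, i ≠ j → Disjoint (f i) (f j)) :
    PerfectlyMatchable G (s.biUnion f) := by
  induction s using Finset.induction_on with
  | empty => simpa using .empty
  | insert i s hi ih =>
    rw [Finset.biUnion_insert]
    refine (hf i (by simp)).union (ih (fun j hj => hf j (by simp [hj]))
      fun j hj l hl => hd j (by simp [hj]) l (by simp [hl])) ?_
    rw [Finset.disjoint_biUnion_right]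
    exact fun j hj => hd i (by simp) j (by simp [hj]) (by rintro rfl; exact hi hj)

theorem exists_subgraph (h : PerfectlyMatchable G S) :
    ∃ M : G.Subgraph, M.IsMatching ∧ M.verts = S ∧ M.edgeSet.Finite ∧
      2 * M.edgeSet.ncard = S.card := by
  induction h with
  | empty => exact ⟨⊥, by simp [Subgraph.IsMatching], by simp, by simp, by simp⟩
  | insertEdge S x y hxy hx hy _ ih =>
    obtain ⟨M, hM, hv, hfin, hc⟩ := ih
    have hnot : s(x, y) ∉ M.edgeSet := fun h => hx (by
      have := M.edge_vert (Subgraph.mem_edgeSet.1 h)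
      rwa [hv] at this)
    refine ⟨G.subgraphOfAdj hxy ⊔ M, ?_, ?_, ?_, ?_⟩
    · refine (Subgraph.IsMatching.subgraphOfAdj hxy).sup hM ?_
      rw [(Subgraph.IsMatching.subgraphOfAdj hxy).support_eq_verts, hM.support_eq_verts, hv]
      simp [hx, hy]
    · ext z; simp [hv, or_assoc]
    · simp [hfin]
    · have : (G.subgraphOfAdj hxy ⊔ M).edgeSet = insert s(x, y) M.edgeSet := by
        simp [Set.singleton_union]
      rw [this, Set.ncard_insert_of_notMem hnot hfin,
        Finset.card_insert_of_notMem (by simp [hx, hxy.ne]), Finset.card_insert_of_notMem hy]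
      omega

theorem hasMatchingOfSize {k : ℕ} (h : PerfectlyMatchable G S) (hS : S.card = 2 * k) :
    hasMatchingOfSize k G := by
  obtain ⟨M, hM, -, -, hc⟩ := h.exists_subgraph
  exact ⟨M, hM, by omega⟩

end PerfectlyMatchable

theorem exists_perfectlyMatchable_of_edges {V : Type*} [DecidableEq V] {G : SimpleGraph V}
    {M : G.Subgraph} (hM : M.IsMatching) (E : Finset (Sym2 V)) (hE : ∀ e ∈ E, e ∈ M.edgeSet) :
    ∃ S : Finset V, PerfectlyMatchable G S ∧ S.card = 2 * E.card ∧ ∀ v ∈ S, ∃ e ∈ E, v ∈ e := by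
  induction E using Finset.induction_on with
  | empty => exact ⟨∅, .empty, by simp, by simp⟩
  | insert e E he ih =>
    obtain ⟨S, hS, hc, hmem⟩ := ih fun f hf => hE f (by simp [hf])
    induction e using Sym2.ind with
    | _ x y =>
    have hxy : M.Adj x y := hE s(x, y) (by simp)
    have key : ∀ v ∈ s(x, y), v ∉ S := by
      intro v hv hvS
      obtain ⟨f, hf, hvf⟩ := hmem v hvS
      refine he ?_
      have hfM := hE f (by simp [hf])
      obtain ⟨a, rfl⟩ := Sym2.mem_iff_exists.1 hvf
      obtain ⟨b, hb⟩ := Sym2.mem_iff_exists.1 hv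
      have hb' : M.Adj v b := by
        have := hE s(x, y) (by simp)
        rwa [hb] at this
      rw [hb, (hM.eq_of_adj_left hb' hfM : b = a)]
      exact hf
    have hx := key x (by simp)
    have hy := key y (by simp)
    refine ⟨insert x (insert y S), .insertEdge S x y hxy.adj_sub hx hy hS, ?_, ?_⟩
    · rw [Finset.card_insert_of_notMem (by simp [hx, hxy.ne]), Finset.card_insert_of_notMem hy,
        Finset.card_insert_of_notMem he]
      omega
    · intro v hv
      simp only [Finset.mem_insert] at hv
      rcases hv with rfl | rfl | hv
      · exact ⟨s(v, y), by simp, by simp⟩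
      · exact ⟨s(x, v), by simp, by simp⟩
      · obtain ⟨f, hf, hvf⟩ := hmem v hv
        exact ⟨f, by simp [hf], hvf⟩

theorem exists_perfectlyMatchable_of_hasMatchingOfSize {V : Type*} [Fintype V] [DecidableEq V]
    {G : SimpleGraph V} {k : ℕ} (h : hasMatchingOfSize k G) :
    ∃ S : Finset V, PerfectlyMatchable G S ∧ S.card = 2 * k := by
  obtain ⟨M, hM, hk⟩ := h
  have hfin : M.edgeSet.Finite := Set.toFinite _
  obtain ⟨S, hS, hc, -⟩ := exists_perfectlyMatchable_of_edges hM hfin.toFinset (by simp)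
  exact ⟨S, hS, by rw [hc, ← Set.ncard_eq_toFinset_card _ hfin, hk]⟩

/-! ### Factor-critical and attachable vertex sets -/

section Good

variable {V : Type*} [DecidableEq V]

/-- The subgraph induced on `S` is nonempty and factor-critical. -/
def FactorCritical (G : SimpleGraph V) (S : Finset V) : Prop :=
  S.Nonempty ∧ ∀ v ∈ S, PerfectlyMatchable G (S.erase v)

/-- The subgraph induced on `S` has a perfect matching, and for every `v ∈ S` there is `w ∈ S` such
that joining a new vertex to `v` and to `w` makes it factor-critical. -/
def Attachable (G : SimpleGraph V) (S : Finset V) : Prop :=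
  PerfectlyMatchable G S ∧ ∀ v ∈ S, ∃ w ∈ S, ∀ z ∈ S,
    (z ≠ v ∧ PerfectlyMatchable G ((S.erase z).erase v)) ∨
      (z ≠ w ∧ PerfectlyMatchable G ((S.erase z).erase w))

/-- Either factor-critical or attachable. -/
def GoodSet (G : SimpleGraph V) (S : Finset V) : Prop :=
  FactorCritical G S ∨ Attachable G S

variable {G H : SimpleGraph V} {S A B : Finset V}

theorem FactorCritical.mono (hGH : G ≤ H) (h : FactorCritical G S) : FactorCritical H S :=
  ⟨h.1, fun v hv => (h.2 v hv).mono hGH⟩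

theorem Attachable.mono (hGH : G ≤ H) (h : Attachable G S) : Attachable H S := by
  refine ⟨h.1.mono hGH, fun v hv => ?_⟩
  obtain ⟨w, hw, hz⟩ := h.2 v hv
  exact ⟨w, hw, fun z hzS => (hz z hzS).imp (fun h => ⟨h.1, h.2.mono hGH⟩)
    fun h => ⟨h.1, h.2.mono hGH⟩⟩

theorem GoodSet.mono (hGH : G ≤ H) (h : GoodSet G S) : GoodSet H S :=
  h.imp (.mono hGH) (.mono hGH)

theorem FactorCritical.odd_card (h : FactorCritical G S) : Odd S.card := by
  obtain ⟨v, hv⟩ := h.1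
  have := (h.2 v hv).even_card
  rw [Finset.card_erase_of_mem hv] at this
  have := Finset.card_pos.2 h.1
  grind

theorem Attachable.even_card (h : Attachable G S) : Even S.card := h.1.even_card

theorem GoodSet.exists_perfectlyMatchable (h : GoodSet G S) :
    ∃ T ⊆ S, PerfectlyMatchable G T ∧ T.card = 2 * (S.card / 2) := by
  rcases h with h | h
  · obtain ⟨v, hv⟩ := h.1
    refine ⟨S.erase v, Finset.erase_subset _ _, h.2 v hv, ?_⟩
    have := h.odd_card
    rw [Finset.card_erase_of_mem hv]
    grind
  · exact ⟨S, subset_rfl, h.1, by have := h.even_card; grind⟩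

theorem FactorCritical.union (hA : FactorCritical G A) (hB : FactorCritical G B)
    (hAB : Disjoint A B) {u v : V} (hu : u ∈ A) (hv : v ∈ B) (huv : G.Adj u v) :
    Attachable G (A ∪ B) := by
  have hd := Finset.disjoint_left.1 hAB
  have hdis : ∀ x y, Disjoint (A.erase x) (B.erase y) := fun x y =>
    hAB.mono (Finset.erase_subset _ _) (Finset.erase_subset _ _)
  have hpm : ∀ x ∈ A, ∀ y ∈ B, x ≠ y ∧ y ≠ x ∧
      PerfectlyMatchable G (((A ∪ B).erase x).erase y) ∧
      PerfectlyMatchable G (((A ∪ B).erase y).erase x) := fun x hx y hy =>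
    ⟨by grind, by grind, (hA.2 x hx).glue (hB.2 y hy) (hdis x y) (by grind),
      (hA.2 x hx).glue (hB.2 y hy) (hdis x y) (by grind)⟩
  refine ⟨(hA.2 u hu).glueEdge (hB.2 v hv) (hdis u v) huv (by grind) (by grind) (by grind), ?_⟩
  intro z₀ hz₀
  rcases Finset.mem_union.1 hz₀ with h₀ | h₀
  · refine ⟨v, by simp [hv], fun z hz => ?_⟩
    rcases Finset.mem_union.1 hz with h | h
    · exact .inr ⟨(hpm z h v hv).1, (hpm z h v hv).2.2.1⟩
    · exact .inl ⟨(hpm z₀ h₀ z h).2.1, (hpm z₀ h₀ z h).2.2.2⟩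
  · refine ⟨u, by simp [hu], fun z hz => ?_⟩
    rcases Finset.mem_union.1 hz with h | h
    · exact .inl ⟨(hpm z h z₀ h₀).1, (hpm z h z₀ h₀).2.2.1⟩
    · exact .inr ⟨(hpm u hu z h).2.1, (hpm u hu z h).2.2.2⟩

theorem FactorCritical.union_of_partner (hA : PerfectlyMatchable G A) (hB : FactorCritical G B)
    (hAB : Disjoint A B) {v w o : V} (hv : v ∈ A) (hw : w ∈ A) (ho : o ∈ B)
    (hvw : ∀ z ∈ A, (z ≠ v ∧ PerfectlyMatchable G ((A.erase z).erase v)) ∨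
      (z ≠ w ∧ PerfectlyMatchable G ((A.erase z).erase w)))
    (hvo : G.Adj v o) (hwo : G.Adj w o) : FactorCritical G (A ∪ B) := by
  have hd := Finset.disjoint_left.1 hAB
  have hdis : ∀ x y z, Disjoint ((A.erase x).erase y) (B.erase z) := fun x y z =>
    hAB.mono ((Finset.erase_subset _ _).trans (Finset.erase_subset _ _)) (Finset.erase_subset _ _)
  refine ⟨⟨v, by simp [hv]⟩, fun z hz => ?_⟩
  rcases Finset.mem_union.1 hz with h | h
  · rcases hvw z h with ⟨hne, hp⟩ | ⟨hne, hp⟩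
    · exact hp.glueEdge (hB.2 o ho) (hdis _ _ _) hvo (by grind) (by grind) (by grind)
    · exact hp.glueEdge (hB.2 o ho) (hdis _ _ _) hwo (by grind) (by grind) (by grind)
  · exact hA.glue (hB.2 z h) (hAB.mono_right (Finset.erase_subset _ _)) (by grind)

theorem erase_erase_union_eq_insert {v x y z : V} (hAB : Disjoint A B) (hx : x ∈ A) (hy : y ∈ B)
    (hv : v ∈ A) (hz : z ∈ B) (hxv : x ≠ v) (hzy : z ≠ y) :
    ((A ∪ B).erase z).erase v =
      insert x (insert y ((A.erase x).erase v ∪ (B.erase z).erase y)) := by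
  have hd := Finset.disjoint_left.1 hAB
  grind

theorem Attachable.union_of_partners (hA : Attachable G A) (hB : Attachable G B)
    (hAB : Disjoint A B) {u w u' w' : V} (hu : u ∈ A) (hw : w ∈ A) (hu' : u' ∈ B) (hw' : w' ∈ B)
    (huw : ∀ z ∈ A, (z ≠ u ∧ PerfectlyMatchable G ((A.erase z).erase u)) ∨
      (z ≠ w ∧ PerfectlyMatchable G ((A.erase z).erase w)))
    (huw' : ∀ z ∈ B, (z ≠ u' ∧ PerfectlyMatchable G ((B.erase z).erase u')) ∨
      (z ≠ w' ∧ PerfectlyMatchable G ((B.erase z).erase w')))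
    (hadj : G.Adj u u') (hadj' : G.Adj w w') : Attachable G (A ∪ B) := by
  have half : ∀ {A B : Finset V}, Attachable G A → Attachable G B → Disjoint A B →
      ∀ {u w u' w' : V}, u ∈ A → w ∈ A → u' ∈ B → w' ∈ B →
      (∀ z ∈ B, (z ≠ u' ∧ PerfectlyMatchable G ((B.erase z).erase u')) ∨
        (z ≠ w' ∧ PerfectlyMatchable G ((B.erase z).erase w'))) →
      G.Adj u u' → G.Adj w w' → ∀ v ∈ A, ∃ t ∈ A ∪ B, ∀ z ∈ A ∪ B,
      (z ≠ v ∧ PerfectlyMatchable G (((A ∪ B).erase z).erase v)) ∨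
        (z ≠ t ∧ PerfectlyMatchable G (((A ∪ B).erase z).erase t)) := by
    intro A B hA hB hAB u w u' w' hu hw hu' hw' huw' hadj hadj' v hv
    have hd := Finset.disjoint_left.1 hAB
    have hdis : ∀ x y x' y', Disjoint ((A.erase x).erase y) ((B.erase x').erase y') :=
      fun x y x' y' => hAB.mono ((Finset.erase_subset _ _).trans (Finset.erase_subset _ _))
        ((Finset.erase_subset _ _).trans (Finset.erase_subset _ _))
    have hdis' : ∀ x y, Disjoint ((A.erase x).erase y) B :=
      fun x y => hAB.mono_left ((Finset.erase_subset _ _).trans (Finset.erase_subset _ _))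
    obtain ⟨t, ht, hvt⟩ := hA.2 v hv
    refine ⟨t, by simp [ht], fun z hz => ?_⟩
    have cross : ∀ x ∈ A, ∀ y ∈ B, G.Adj x y → z ∈ B → z ≠ y →
        PerfectlyMatchable G ((B.erase z).erase y) →
        (z ≠ v ∧ PerfectlyMatchable G (((A ∪ B).erase z).erase v)) ∨
        (z ≠ t ∧ PerfectlyMatchable G (((A ∪ B).erase z).erase t)) := by
      intro x hx y hy hxy hzB hzy hp
      rcases hvt x hx with ⟨hne, hq⟩ | ⟨hne, hq⟩
      · exact .inl ⟨by grind, hq.glueEdge hp (hdis _ _ _ _) hxy (by grind) (by grind)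
          (erase_erase_union_eq_insert hAB hx hy hv hzB hne hzy)⟩
      · exact .inr ⟨by grind, hq.glueEdge hp (hdis _ _ _ _) hxy (by grind) (by grind)
          (erase_erase_union_eq_insert hAB hx hy ht hzB hne hzy)⟩
    rcases Finset.mem_union.1 hz with h | h
    · rcases hvt z h with ⟨hne, hp⟩ | ⟨hne, hp⟩
      · exact .inl ⟨hne, hp.glue hB.1 (hdis' _ _) (by grind)⟩
      · exact .inr ⟨hne, hp.glue hB.1 (hdis' _ _) (by grind)⟩
    · rcases huw' z h with ⟨hne, hp⟩ | ⟨hne, hp⟩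
      · exact cross u hu u' hu' hadj h hne hp
      · exact cross w hw w' hw' hadj' h hne hp
  refine ⟨hA.1.union hB.1 hAB, fun v hv => ?_⟩
  rcases Finset.mem_union.1 hv with h | h
  · exact half hA hB hAB hu hw hu' hw' huw' hadj hadj' v h
  · rw [Finset.union_comm]
    exact half hB hA hAB.symm hu' hw' hu hw huw hadj.symm hadj'.symm v h

end Good

/-! ### Colour classes -/

section Colour

variable {V : Type*} [Fintype V] [DecidableEq V]

/-- The vertices of colour `i`. -/
def colourClass (c : V → V) (i : V) : Finset V := Finset.univ.filter (c · = i)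

/-- The largest matching number of a graph whose edges join vertices of the same colour. -/
def matchingBound (c : V → V) : ℕ := ∑ i, (colourClass c i).card / 2

/-- The colouring obtained from `c` by giving colour `a` to the vertices of colour `b`. -/
def mergeColours (c : V → V) (a b : V) : V → V := fun v => if c v = b then a else c v

variable {G H : SimpleGraph V} {c : V → V} {a b : V}

@[simp]
theorem mem_colourClass {i v : V} : v ∈ colourClass c i ↔ c v = i := by simp [colourClass]

theorem disjoint_colourClass {i j : V} (h : i ≠ j) :
    Disjoint (colourClass c i) (colourClass c j) := by
  rw [Finset.disjoint_left]
  grind [mem_colourClass]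

theorem sum_card_colourClass (c : V → V) : ∑ i, (colourClass c i).card = Fintype.card V := by
  rw [← Finset.card_univ, Finset.card_eq_sum_card_fiberwise (f := c) (t := Finset.univ) (by simp)]
  rfl

theorem colourClass_mergeColours_left :
    colourClass (mergeColours c a b) a = colourClass c a ∪ colourClass c b := by
  ext v
  simp only [mem_colourClass, Finset.mem_union, mergeColours]
  grind

theorem colourClass_mergeColours_right (hab : a ≠ b) :
    colourClass (mergeColours c a b) b = ∅ := by
  ext v
  simp only [mem_colourClass, mergeColours]
  grind

theorem colourClass_mergeColours_of_ne {i : V} (ha : i ≠ a) (hb : i ≠ b) :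
    colourClass (mergeColours c a b) i = colourClass c i := by
  ext v
  simp only [mem_colourClass, mergeColours]
  grind

theorem matchingBound_mergeColours (hab : a ≠ b) :
    matchingBound (mergeColours c a b) + (colourClass c a).card / 2 + (colourClass c b).card / 2 =
      matchingBound c + ((colourClass c a).card + (colourClass c b).card) / 2 := by
  have split : ∀ f : V → ℕ, ∑ i, f i = f a + (f b + ∑ i ∈ (Finset.univ.erase a).erase b, f i) :=
    fun f => by
      rw [Finset.add_sum_erase _ f (by simp [hab.symm]), Finset.add_sum_erase _ f (by simp)]
  have hrest : ∑ i ∈ (Finset.univ.erase a).erase b, (colourClass (mergeColours c a b) i).card / 2 =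
      ∑ i ∈ (Finset.univ.erase a).erase b, (colourClass c i).card / 2 :=
    Finset.sum_congr rfl fun i hi => by
      simp only [Finset.mem_erase] at hi
      rw [colourClass_mergeColours_of_ne hi.2.1 hi.1]
  rw [matchingBound, matchingBound, split, split (fun i => (colourClass c i).card / 2), hrest,
    colourClass_mergeColours_left, colourClass_mergeColours_right hab,
    Finset.card_union_of_disjoint (disjoint_colourClass hab)]
  simp only [Finset.card_empty]
  omega

/-- Edges of `G` join vertices of the same colour. -/
def Respects (G : SimpleGraph V) (c : V → V) : Prop := ∀ x y, G.Adj x y → c x = c y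

theorem Respects.not_hasMatchingOfSize {k : ℕ} (h : Respects G c) (hk : matchingBound c < k) :
    ¬ hasMatchingOfSize k G := by
  intro hm
  obtain ⟨S, hS, hc⟩ := exists_perfectlyMatchable_of_hasMatchingOfSize hm
  have hsum := Finset.card_eq_sum_card_fiberwise (s := S) (f := c) (t := Finset.univ) (by simp)
  have hle : S.card ≤ 2 * matchingBound c := by
    rw [hsum, matchingBound, Finset.mul_sum]
    refine Finset.sum_le_sum fun i _ => ?_
    have heven := hS.even_card_filter (fun v => c v = i) fun x y hxy => by rw [h x y hxy]
    have hcard : (S.filter fun v => c v = i).card ≤ (colourClass c i).card :=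
      Finset.card_le_card fun v hv => by simpa using (Finset.mem_filter.1 hv).2
    grind
  omega

theorem hasMatchingOfSize_matchingBound (h : ∀ i, GoodSet G (colourClass c i)) :
    hasMatchingOfSize (matchingBound c) G := by
  choose T hsub hT hcard using fun i => (h i).exists_perfectlyMatchable
  have hd : ∀ i j, i ≠ j → Disjoint (T i) (T j) := fun i j hij =>
    (disjoint_colourClass hij).mono (hsub i) (hsub j)
  refine (PerfectlyMatchable.biUnion Finset.univ T (fun i _ => hT i)
    fun i _ j _ => hd i j).hasMatchingOfSize ?_
  rw [Finset.card_biUnion fun i _ j _ => hd i j, matchingBound, Finset.mul_sum]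
  exact Finset.sum_congr rfl fun i _ => hcard i

/-- The disjoint union of the complete graphs on the colour classes. -/
def colourCliques (c : V → V) : SimpleGraph V where
  Adj x y := x ≠ y ∧ c x = c y
  symm := ⟨fun _ _ h => ⟨h.1.symm, h.2.symm⟩⟩
  loopless := ⟨fun _ h => h.1 rfl⟩

theorem ncard_edgeSet_colourCliques (c : V → V) :
    (colourCliques c).edgeSet.ncard = ∑ i, (colourClass c i).card.choose 2 := by
  classical
  have hdeg : ∀ v, (colourCliques c).degree v = (colourClass c (c v)).card - 1 := fun v => by
    rw [← Finset.card_erase_of_mem (s := colourClass c (c v)) (a := v) (by simp),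
      ← SimpleGraph.card_neighborFinset_eq_degree]
    congr 1
    ext w
    rw [SimpleGraph.mem_neighborFinset]
    simp [colourCliques, eq_comm]
  have hsum := (colourCliques c).sum_degrees_eq_twice_card_edges
  have hfib : ∑ v, (colourCliques c).degree v =
      ∑ i, (colourClass c i).card * ((colourClass c i).card - 1) := by
    rw [← Finset.sum_fiberwise Finset.univ c]
    refine Finset.sum_congr rfl fun i _ => ?_
    rw [Finset.sum_congr rfl (g := fun _ => (colourClass c i).card - 1)]
    · simp [colourClass]
    · intro v hv
      rw [hdeg, (Finset.mem_filter.1 hv).2]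
  have hchoose : ∑ i, (colourClass c i).card * ((colourClass c i).card - 1) =
      2 * ∑ i, (colourClass c i).card.choose 2 := by
    rw [Finset.mul_sum]
    refine Finset.sum_congr rfl fun i _ => ?_
    rw [Nat.choose_two_right, Nat.mul_div_cancel' (Nat.even_mul_pred_self _).two_dvd]
  rw [← SimpleGraph.coe_edgeFinset, Set.ncard_coe_finset]
  omega

theorem choose_two_mod_two (m : ℕ) : m.choose 2 % 2 = m / 2 % 2 := by
  rw [Nat.choose_two_right]
  obtain ⟨r, rfl | rfl⟩ := Nat.even_or_odd' m
  · rw [mul_assoc, Nat.mul_div_cancel_left _ two_pos, Nat.mul_div_cancel_left _ two_pos]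
    rcases r with _ | r
    · rfl
    · rw [Nat.mul_mod, show (2 * (r + 1) - 1) % 2 = 1 by omega]
      simp
  · rw [Nat.add_sub_cancel, mul_left_comm, Nat.mul_div_cancel_left _ two_pos,
      show (2 * r + 1) / 2 = r by omega, Nat.mul_mod]
    simp [Nat.add_mod]

theorem ncard_edgeSet_colourCliques_mod_two (c : V → V) :
    (colourCliques c).edgeSet.ncard % 2 = matchingBound c % 2 := by
  rw [ncard_edgeSet_colourCliques, matchingBound, Finset.sum_nat_mod, Finset.sum_nat_mod _ _
    (fun i => (colourClass c i).card / 2)]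
  simp only [choose_two_mod_two]

theorem Respects.ncard_edgeSet_le {k : ℕ} (h : Respects G c) (hk : matchingBound c < k) :
    G.edgeSet.ncard ≤ (2 * k - 1).choose 2 := by
  have hle : G ≤ colourCliques c := fun x y hxy => ⟨hxy.ne, h x y hxy⟩
  refine (Set.ncard_le_ncard (SimpleGraph.edgeSet_mono hle)).trans ?_
  rw [ncard_edgeSet_colourCliques]
  obtain ⟨r, rfl⟩ : ∃ r, k = r + 1 := ⟨k - 1, by omega⟩
  have hr : (2 * (r + 1) - 1).choose 2 = (2 * r + 1) * r := by
    rw [Nat.choose_two_right, show 2 * (r + 1) - 1 = 2 * r + 1 by omega, Nat.add_sub_cancel,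
      mul_left_comm, Nat.mul_div_cancel_left _ two_pos]
  calc ∑ i, (colourClass c i).card.choose 2
      ≤ ∑ i, (2 * r + 1) * ((colourClass c i).card / 2) := by
        refine Finset.sum_le_sum fun i _ => ?_
        have hi : (colourClass c i).card / 2 ≤ matchingBound c :=
          Finset.single_le_sum (f := fun i => (colourClass c i).card / 2)
            (fun _ _ => Nat.zero_le _) (Finset.mem_univ i)
        obtain ⟨b, hb⟩ := Nat.even_or_odd' (colourClass c i).card
        rw [Nat.choose_two_right]
        rcases hb with hb | hb <;> rw [hb] at hi ⊢
        · rw [mul_assoc, Nat.mul_div_cancel_left _ two_pos, Nat.mul_div_cancel_left _ two_pos,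
            mul_comm]
          exact Nat.mul_le_mul_right _ (by omega)
        · rw [Nat.add_sub_cancel, mul_left_comm, Nat.mul_div_cancel_left _ two_pos,
            show (2 * b + 1) / 2 = b by omega]
          exact Nat.mul_le_mul_right _ (by omega)
    _ = (2 * r + 1) * matchingBound c := by rw [matchingBound, Finset.mul_sum]
    _ ≤ (2 * (r + 1) - 1).choose 2 := by
        rw [hr]
        exact Nat.mul_le_mul_left _ (by omega)

theorem exists_two_odd_colourClasses (h : 2 * matchingBound c + 2 ≤ Fintype.card V) :
    ∃ x y, c x ≠ c y ∧ Odd (colourClass c (c x)).card ∧ Odd (colourClass c (c y)).card := by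
  have hcard : Fintype.card V =
      2 * matchingBound c + (Finset.univ.filter fun i => Odd (colourClass c i).card).card := by
    rw [← sum_card_colourClass c, matchingBound, Finset.mul_sum, Finset.card_filter,
      ← Finset.sum_add_distrib]
    refine Finset.sum_congr rfl fun i _ => ?_
    split_ifs <;> grind
  obtain ⟨i, hi, j, hj, hij⟩ := Finset.one_lt_card.1
    (show 1 < (Finset.univ.filter fun i => Odd (colourClass c i).card).card by omega)
  simp only [Finset.mem_filter, Finset.mem_univ, true_and] at hi hj
  obtain ⟨x, hx⟩ := Finset.card_pos.1 hi.pos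
  obtain ⟨y, hy⟩ := Finset.card_pos.1 hj.pos
  rw [mem_colourClass] at hx hy
  subst hx hy
  exact ⟨x, y, hij, hi, hj⟩

end Colour

/-! ### Adding an edge -/

section AddEdge

variable {V : Type*} {G : SimpleGraph V} {x y u v : V}

theorem le_addEdge (G : SimpleGraph V) (e : Sym2 V) : G ≤ addEdge G e := le_sup_left

theorem addEdge_adj_iff :
    (addEdge G s(x, y)).Adj u v ↔ G.Adj u v ∨ (s(u, v) = s(x, y) ∧ u ≠ v) := by
  simp [addEdge]

theorem addEdge_adj (h : x ≠ y) : (addEdge G s(x, y)).Adj x y :=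
  addEdge_adj_iff.2 (.inr ⟨rfl, h⟩)

theorem ncard_edgeSet_addEdge [Finite V] (e : Sym2 V) (hd : ¬ e.IsDiag) (he : e ∉ G.edgeSet) :
    (addEdge G e).edgeSet.ncard = G.edgeSet.ncard + 1 := by
  have : (addEdge G e).edgeSet = insert e G.edgeSet := by
    ext f
    simp only [addEdge, edgeSet_sup, edgeSet_fromEdgeSet, Set.mem_union, Set.mem_sdiff,
      Set.mem_singleton_iff, Set.mem_insert_iff]
    constructor
    · tauto
    · rintro (rfl | h)
      · exact .inr ⟨rfl, hd⟩
      · exact .inl h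
  rw [this, Set.ncard_insert_of_notMem he (Set.toFinite _)]

variable {c : V → V}

theorem Respects.addEdge (h : Respects G c) (hxy : c x = c y) :
    Respects (addEdge G s(x, y)) c := by
  intro a b hab
  rcases addEdge_adj_iff.1 hab with hab | ⟨hab, -⟩
  · exact h a b hab
  · rcases Sym2.eq_iff.1 hab with ⟨rfl, rfl⟩ | ⟨rfl, rfl⟩
    · exact hxy
    · exact hxy.symm

theorem Respects.mergeColours [DecidableEq V] (h : Respects G c) (a b : V) :
    Respects G (mergeColours c a b) :=
  fun x y hxy => by simp [_root_.mergeColours, h x y hxy]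

theorem respects_merge_addEdge [DecidableEq V] (h : Respects G c) :
    Respects (addEdge G s(x, y)) (mergeColours c (c x) (c y)) :=
  (h.mergeColours _ _).addEdge (by simp [mergeColours])

end AddEdge

/-! ### Mini's strategy -/

section Strategy

variable {V : Type*} [Fintype V] [DecidableEq V]

/-- The positions of the game for matchings of size `k` that Mini maintains. -/
structure GoodPosition (k : ℕ) (G : SimpleGraph V) (c : V → V) : Prop where
  respects : Respects G c
  good : ∀ i, GoodSet G (colourClass c i)
  bound : matchingBound c < k

variable {k : ℕ} {G : SimpleGraph V} {c : V → V} {x y : V}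

theorem GoodPosition.addEdge (h : GoodPosition k G c) (hxy : c x = c y) :
    GoodPosition k (addEdge G s(x, y)) c :=
  ⟨h.respects.addEdge hxy, fun i => (h.good i).mono (le_addEdge _ _), h.bound⟩

theorem GoodPosition.legalMove_of_respects {c' : V → V} (hne : x ≠ y) (hxy : ¬ G.Adj x y)
    (h : Respects (_root_.addEdge G s(x, y)) c') (hk : matchingBound c' < k) :
    legalMove (hasMatchingOfSize k) G s(x, y) :=
  ⟨by simpa using hne, by simpa using hxy, h.not_hasMatchingOfSize hk⟩

theorem goodSet_mergeColours {H : SimpleGraph V} (hGH : G ≤ H)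
    (hgood : ∀ i, GoodSet G (colourClass c i)) (hxy : c x ≠ c y)
    (hm : GoodSet H (colourClass c (c x) ∪ colourClass c (c y))) (i : V) :
    GoodSet H (colourClass (mergeColours c (c x) (c y)) i) := by
  by_cases hx : i = c x
  · rw [hx, colourClass_mergeColours_left]
    exact hm
  by_cases hy : i = c y
  · rw [hy, colourClass_mergeColours_right hxy]
    exact .inr ⟨.empty, by simp⟩
  · rw [colourClass_mergeColours_of_ne hx hy]
    exact (hgood i).mono hGH

/-- If Max joins two colour classes, at least one of which is attachable, then Mini can answer so as
to restore a good position in which these two classes are merged. -/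
theorem GoodPosition.exists_reply (h : GoodPosition k G c) (hxy : c x ≠ c y)
    (hA : Attachable G (colourClass c (c x))) :
    ∃ p q c', legalMove (hasMatchingOfSize k) (_root_.addEdge G s(x, y)) s(p, q) ∧
      GoodPosition k (_root_.addEdge (_root_.addEdge G s(x, y)) s(p, q)) c' := by
  have hne : x ≠ y := by rintro rfl; exact hxy rfl
  have hbound : matchingBound (mergeColours c (c x) (c y)) < k := by
    have h₁ := matchingBound_mergeColours (c := c) hxy
    have h₂ := hA.even_card
    have h₃ := h.bound
    grind
  have hd := disjoint_colourClass (c := c) hxy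
  obtain ⟨w, hw, hxw⟩ := hA.2 x (by simp)
  have hwx : w ≠ x := by
    rcases hxw x (by simp) with h | h
    · exact absurd rfl h.1
    · exact h.1.symm
  rw [mem_colourClass] at hw
  have finish : ∀ q, c q = c y →
      GoodSet (_root_.addEdge (_root_.addEdge G s(x, y)) s(w, q))
        (colourClass c (c x) ∪ colourClass c (c y)) →
      ∃ p q c', legalMove (hasMatchingOfSize k) (_root_.addEdge G s(x, y)) s(p, q) ∧
        GoodPosition k (_root_.addEdge (_root_.addEdge G s(x, y)) s(p, q)) c' := by
    intro q hq hgood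
    have hwq : w ≠ q := by rintro rfl; exact hxy (hw.symm.trans hq)
    have hr : Respects (_root_.addEdge (_root_.addEdge G s(x, y)) s(w, q))
        (mergeColours c (c x) (c y)) :=
      (respects_merge_addEdge h.respects).addEdge (by simp [mergeColours, hw, hq])
    refine ⟨w, q, _, GoodPosition.legalMove_of_respects hwq ?_ hr hbound, hr,
      goodSet_mergeColours ((le_addEdge _ _).trans (le_addEdge _ _)) h.good hxy hgood, hbound⟩
    rw [addEdge_adj_iff]
    rintro (hadj | ⟨heq, -⟩)
    · exact hxy (by rw [← hw, ← hq, h.respects _ _ hadj])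
    · rcases Sym2.eq_iff.1 heq with ⟨h₁, -⟩ | ⟨h₁, -⟩
      · exact hwx h₁
      · exact hxy (by rw [← hw, h₁])
  have hle : ∀ q, G ≤ _root_.addEdge (_root_.addEdge G s(x, y)) s(w, q) := fun q =>
    (le_addEdge _ _).trans (le_addEdge _ _)
  have hadj : ∀ q, (_root_.addEdge (_root_.addEdge G s(x, y)) s(w, q)).Adj x y := fun q =>
    le_addEdge _ _ (addEdge_adj hne)
  have hadj' : ∀ q, c q = c y → (_root_.addEdge (_root_.addEdge G s(x, y)) s(w, q)).Adj w q :=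
    fun q hq => addEdge_adj (by rintro rfl; exact hxy (hw.symm.trans hq))
  have partner : ∀ {H : SimpleGraph V} {S : Finset V} {v w : V}, G ≤ H →
      (∀ z ∈ S, (z ≠ v ∧ PerfectlyMatchable G ((S.erase z).erase v)) ∨
        (z ≠ w ∧ PerfectlyMatchable G ((S.erase z).erase w))) →
      ∀ z ∈ S, (z ≠ v ∧ PerfectlyMatchable H ((S.erase z).erase v)) ∨
        (z ≠ w ∧ PerfectlyMatchable H ((S.erase z).erase w)) :=
    fun hGH h z hz => (h z hz).imp (.imp_right (.mono hGH)) (.imp_right (.mono hGH))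
  rcases h.good (c y) with hB | hB
  · exact finish y rfl (.inl (FactorCritical.union_of_partner (hA.1.mono (hle y))
      (hB.mono (hle y)) hd (by simp) (by simpa using hw) (by simp)
      (partner (hle y) hxw) (hadj y) (hadj' y rfl)))
  · obtain ⟨w', hw', hyw'⟩ := hB.2 y (by simp)
    have hq := mem_colourClass.1 hw'
    exact finish w' hq (.inr ((hA.mono (hle w')).union_of_partners (hB.mono (hle w')) hd (by simp)
      (by simpa using hw) (by simp) hw' (partner (hle w') hxw) (partner (hle w') hyw') (hadj w')
      (hadj' w' hq)))

/-- Joining two factor-critical colour classes gives a good position, unless it creates a matching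
that is too large. -/
theorem GoodPosition.merge_of_factorCritical (h : GoodPosition k G c) (hxy : c x ≠ c y)
    (hA : FactorCritical G (colourClass c (c x))) (hB : FactorCritical G (colourClass c (c y)))
    (hk : matchingBound c + 1 < k ∨ ¬ hasMatchingOfSize k (_root_.addEdge G s(x, y))) :
    GoodPosition k (_root_.addEdge G s(x, y)) (mergeColours c (c x) (c y)) := by
  have hne : x ≠ y := by rintro rfl; exact hxy rfl
  have hgood := goodSet_mergeColours (le_addEdge G s(x, y)) h.good hxy
    (.inr ((hA.mono (le_addEdge _ _)).union (hB.mono (le_addEdge _ _)) (disjoint_colourClass hxy)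
      (by simp) (by simp) (addEdge_adj hne)))
  refine ⟨respects_merge_addEdge h.respects, hgood, ?_⟩
  have h₁ := matchingBound_mergeColours (c := c) hxy
  have h₂ := hA.odd_card
  have h₃ := hB.odd_card
  have h₄ := h.bound
  have h₅ : matchingBound (mergeColours c (c x) (c y)) = matchingBound c + 1 := by grind
  rcases hk with hk | hk
  · omega
  · have h₆ : matchingBound (mergeColours c (c x) (c y)) ≠ k := fun heq =>
      hk (heq ▸ hasMatchingOfSize_matchingBound hgood)
    omega

/-- In a good position where Mini is to move and the parity of the number of edges is right, Mini
has a move leading to a good position. -/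
theorem GoodPosition.exists_move (h : GoodPosition k G c) (hn : 2 * k ≤ Fintype.card V)
    (hpar : G.edgeSet.ncard % 2 = k % 2) :
    ∃ p q c', legalMove (hasMatchingOfSize k) G s(p, q) ∧
      GoodPosition k (_root_.addEdge G s(p, q)) c' := by
  by_cases hint : ∃ p q, p ≠ q ∧ c p = c q ∧ ¬ G.Adj p q
  · obtain ⟨p, q, hne, hc, hadj⟩ := hint
    exact ⟨p, q, c, legalMove_of_respects hne hadj (h.respects.addEdge hc) h.bound, h.addEdge hc⟩
  · have hG : G = colourCliques c := by
      ext p q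
      refine ⟨fun hpq => ⟨hpq.ne, h.respects p q hpq⟩, fun hpq => ?_⟩
      by_contra hadj
      exact hint ⟨p, q, hpq.1, hpq.2, hadj⟩
    have hmod := ncard_edgeSet_colourCliques_mod_two c
    rw [← hG] at hmod
    have hb := h.bound
    obtain ⟨p, q, hpq, hp, hq⟩ := exists_two_odd_colourClasses (c := c) (by omega)
    have fc : ∀ i, Odd (colourClass c i).card → FactorCritical G (colourClass c i) := fun i hi =>
      (h.good i).resolve_right fun hatt => Nat.not_even_iff_odd.2 hi hatt.even_card
    have hpos := h.merge_of_factorCritical hpq (fc _ hp) (fc _ hq) (.inl (by omega))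
    exact ⟨p, q, _, legalMove_of_respects (by rintro rfl; exact hpq rfl)
      (fun hadj => hpq (h.respects p q hadj)) hpos.respects hpos.bound, hpos⟩

theorem GoodPosition.gameEnsures (hn : 2 * k ≤ Fintype.card V) (N : ℕ) :
    ∀ (G : SimpleGraph V) (c : V → V), GoodPosition k G c →
      Nat.card (Sym2 V) ≤ G.edgeSet.ncard + N →
      (G.edgeSet.ncard % 2 = k % 2 → GameEnsures (hasMatchingOfSize k)
        (fun G : SimpleGraph V => G.edgeSet.ncard ≤ (2 * k - 1).choose 2) true G) ∧
      (G.edgeSet.ncard % 2 ≠ k % 2 → GameEnsures (hasMatchingOfSize k)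
        (fun G : SimpleGraph V => G.edgeSet.ncard ≤ (2 * k - 1).choose 2) false G) := by
  induction N using Nat.strong_induction_on with
  | _ N ih =>
  intro G c h hN
  have hlt : ∀ {G : SimpleGraph V} {e}, legalMove (hasMatchingOfSize k) G e →
      (_root_.addEdge G e).edgeSet.ncard = G.edgeSet.ncard + 1 ∧
        G.edgeSet.ncard < Nat.card (Sym2 V) := by
    intro G e he
    have h₁ := ncard_edgeSet_addEdge e he.1 he.2.1
    have h₂ := Set.ncard_le_card (_root_.addEdge G e).edgeSet
    exact ⟨h₁, by omega⟩
  constructor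
  · intro hpar
    obtain ⟨p, q, c', hl, h'⟩ := h.exists_move hn hpar
    have hs := hlt hl
    exact .protagonistMove G _ hl ((ih (N - 1) (by omega) _ c' h' (by omega)).2 (by omega))
  · intro hpar
    by_cases hend : ∀ e, ¬ legalMove (hasMatchingOfSize k) G e
    · exact .gameOver _ G hend (h.respects.ncard_edgeSet_le h.bound)
    push Not at hend
    obtain ⟨e₀, he₀⟩ := hend
    refine .opponentMove G e₀ he₀ fun e he => ?_
    have hs := hlt he
    have tempo : ∀ c', GoodPosition k (_root_.addEdge G e) c' → GameEnsures (hasMatchingOfSize k)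
        (fun G : SimpleGraph V => G.edgeSet.ncard ≤ (2 * k - 1).choose 2) true
        (_root_.addEdge G e) := fun c' h' =>
      (ih (N - 1) (by omega) _ c' h' (by omega)).1 (by omega)
    have reply : (∃ p q c', legalMove (hasMatchingOfSize k) (_root_.addEdge G e) s(p, q) ∧
        GoodPosition k (_root_.addEdge (_root_.addEdge G e) s(p, q)) c') →
        GameEnsures (hasMatchingOfSize k)
        (fun G : SimpleGraph V => G.edgeSet.ncard ≤ (2 * k - 1).choose 2) true
        (_root_.addEdge G e) := by
      rintro ⟨p, q, c', hl, h'⟩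
      have hs' := hlt hl
      exact .protagonistMove _ _ hl ((ih (N - 2) (by omega) _ c' h' (by omega)).2 (by omega))
    induction e using Sym2.ind with
    | _ x y =>
    by_cases hxy : c x = c y
    · exact tempo c (h.addEdge hxy)
    rcases h.good (c x) with hA | hA
    · rcases h.good (c y) with hB | hB
      · exact tempo _ (h.merge_of_factorCritical hxy hA hB (.inr he.2.2))
      · rw [Sym2.eq_swap] at reply ⊢
        exact reply (h.exists_reply (Ne.symm hxy) hB)
    · exact reply (h.exists_reply hxy hA)

theorem goodPosition_bot (hk : 0 < k) : GoodPosition k (⊥ : SimpleGraph V) id := by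
  have hcls : ∀ i : V, colourClass id i = {i} := fun i => by ext v; simp
  refine ⟨fun _ _ h => h.elim, fun i => .inl ?_, ?_⟩
  · rw [hcls]
    exact ⟨by simp, fun v hv => by
      rw [Finset.mem_singleton.1 hv, Finset.erase_singleton]
      exact .empty⟩
  · simpa [matchingBound, hcls] using hk

end Strategy

/-- In the saturation game `(n, M_k)` with `k ≥ 2` and `n ≥ 2k`: if Max moves first and
`k` is odd (so Mini, the protagonist here, moves second), or Mini moves first and `k` is
even, then Mini can guarantee a final score of at most `C(2k-1, 2)`. -/
theorem statement_6 (k n : ℕ) (hk : 2 ≤ k) (hn : 2 * k ≤ n) :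
    (Odd k →
      GameEnsures (hasMatchingOfSize k)
        (fun G : SimpleGraph (Fin n) => G.edgeSet.ncard ≤ (2 * k - 1).choose 2) false ⊥) ∧
    (Even k →
      GameEnsures (hasMatchingOfSize k)
        (fun G : SimpleGraph (Fin n) => G.edgeSet.ncard ≤ (2 * k - 1).choose 2) true ⊥) := by
  have h := GoodPosition.gameEnsures (V := Fin n) (k := k) (by simpa using hn)
    (Nat.card (Sym2 (Fin n))) ⊥ id (goodPosition_bot (by omega)) (by omega)
  simp only [edgeSet_bot, Set.ncard_empty, Nat.zero_mod] at h
  exact ⟨fun hodd => h.2 (by rw [Nat.odd_iff.1 hodd]; decide),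
    fun heven => h.1 (Nat.even_iff.1 heven).symm⟩
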